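/- Let α > 0 be a noninteger real number, n = ⌊α⌋ + 1, a ∈ ℤ, f : ℤ → ℝ, and t ∈ ℤ with t ≥ a + 1. Then the nabla left Caputo and Riemann fractional differences are related by (^C∇_a^{α} f)(t) = (∇_a^{α} f)(t) − Σ_{k=0}^{n−1} [Γ(t−a+k−α)/(Γ(t−a)·Γ(k−α+1))]·(∇^k f)(a). -/

import Mathlib

/-- Backward difference operator: `(∇ f)(t) = f t − f (t−1)`. -/
def nablaOp (f : ℤ → ℝ) : ℤ → ℝ := fun t => f t - f (t - 1)

/-- Forward difference operator: `(Δ f)(t) = f (t+1) − f t`. -/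
def deltaOp (f : ℤ → ℝ) : ℤ → ℝ := fun t => f (t + 1) - f t

/-- The operator `−Δ`. -/
def negDeltaOp (f : ℤ → ℝ) : ℤ → ℝ := fun t => -(f (t + 1) - f t)

/-- Nabla left fractional sum of order `α` starting at `a`:
`(∇_a^{-α} f)(t) = (1/Γ(α)) Σ_{s=a+1}^{t} [Γ(t−s+α)/Γ(t−s+1)] f(s)`. -/
noncomputable def nablaLeftSum (a : ℤ) (α : ℝ) (f : ℤ → ℝ) : ℤ → ℝ := fun t =>
  (1 / Real.Gamma α) * ∑ s ∈ Finset.Icc (a + 1) t,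
    (Real.Gamma ((t : ℝ) - (s : ℝ) + α) / Real.Gamma ((t : ℝ) - (s : ℝ) + 1)) * f s

/-- Nabla right fractional sum of order `α` ending at `b`:
`(_b∇^{-α} f)(t) = (1/Γ(α)) Σ_{s=t}^{b−1} [Γ(s−t+α)/Γ(s−t+1)] f(s)`. -/
noncomputable def nablaRightSum (b : ℤ) (α : ℝ) (f : ℤ → ℝ) : ℤ → ℝ := fun t =>
  (1 / Real.Gamma α) * ∑ s ∈ Finset.Icc t (b - 1),
    (Real.Gamma ((s : ℝ) - (t : ℝ) + α) / Real.Gamma ((s : ℝ) - (t : ℝ) + 1)) * f s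

/-- The kernel `Γ(m + β) / (Γ(m + 1) Γ(β))` of the nabla fractional sum of order `β`; it vanishes
for `m < 0`. -/
noncomputable def nablaKernel (β : ℝ) (m : ℤ) : ℝ :=
  Real.Gamma ((m : ℝ) + β) / (Real.Gamma ((m : ℝ) + 1) * Real.Gamma β)

theorem nablaKernel_of_neg (β : ℝ) {m : ℤ} (hm : m < 0) : nablaKernel β m = 0 := by
  obtain ⟨j, hj⟩ := Int.eq_ofNat_of_zero_le (show 0 ≤ -(m + 1) by omega)
  have hm' : (m : ℝ) + 1 = -(j : ℝ) := by
    have : m + 1 = -(j : ℤ) := by omega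
    exact_mod_cast this
  rw [nablaKernel, hm', Real.Gamma_neg_nat_eq_zero, zero_mul, div_zero]

theorem nablaKernel_sub (β : ℝ) (hβ : ∀ j : ℤ, β ≠ j) (m : ℤ) :
    nablaKernel β m - nablaKernel β (m - 1) = nablaKernel (β - 1) m := by
  have hΓ (j : ℤ) : Real.Gamma (j + β) ≠ 0 := Real.Gamma_ne_zero fun i h ↦ by
    refine hβ (-i - j) ?_
    push_cast
    linarith
  have hβ1 : β - 1 ≠ 0 := fun h ↦ hβ 1 (by push_cast; linarith)
  have hrec : Real.Gamma β = (β - 1) * Real.Gamma (β - 1) := by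
    simpa using Real.Gamma_add_one hβ1
  have h0 : Real.Gamma (β - 1) ≠ 0 := by
    have := hΓ (-1)
    rwa [show ((-1 : ℤ) : ℝ) + β = β - 1 by push_cast; ring] at this
  rcases lt_trichotomy m 0 with hm | rfl | hm
  · simp [nablaKernel_of_neg _ hm, nablaKernel_of_neg β (show m - 1 < 0 by omega)]
  · rw [nablaKernel_of_neg β (show (0 : ℤ) - 1 < 0 by omega)]
    have h1 : Real.Gamma β ≠ 0 := by simpa using hΓ 0
    simp [nablaKernel, h0, h1]
  · have hm0 : (0 : ℝ) < m := by exact_mod_cast hm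
    have hne : (m : ℝ) + β - 1 ≠ 0 := fun h ↦ hβ (1 - m) (by push_cast; linarith)
    have e1 : Real.Gamma (m + β) = (m + β - 1) * Real.Gamma (m + β - 1) := by
      simpa using Real.Gamma_add_one hne
    have e2 := Real.Gamma_add_one hm0.ne'
    have h2 := (Real.Gamma_pos_of_pos hm0).ne'
    simp only [nablaKernel]
    push_cast
    rw [show (m : ℝ) - 1 + β = m + β - 1 by ring, sub_add_cancel,
      show (m : ℝ) + (β - 1) = m + β - 1 by ring, e1, e2, hrec]
    field_simp
    ring

theorem nablaLeftSum_eq_sum_nablaKernel (a : ℤ) (β : ℝ) (f : ℤ → ℝ) (t : ℤ) :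
    nablaLeftSum a β f t = ∑ s ∈ Finset.Icc (a + 1) t, nablaKernel β (t - s) * f s := by
  simp only [nablaLeftSum, nablaKernel, Finset.mul_sum]
  refine Finset.sum_congr rfl fun s _ ↦ ?_
  push_cast
  rw [← mul_assoc, div_mul_div_comm, one_mul, mul_comm (Real.Gamma β)]

/-- Summation by parts: a fractional sum of a backward difference is the backward difference of the
fractional sum, up to a boundary term. -/
theorem nablaLeftSum_nablaOp (a : ℤ) (β : ℝ) (f : ℤ → ℝ) (t : ℤ) :
    nablaLeftSum a β (nablaOp f) t =
      nablaOp (nablaLeftSum a β f) t - nablaKernel β (t - a - 1) * f a := by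
  have hshift : ∑ s ∈ Finset.Icc (a + 1) t, nablaKernel β (t - s) * f (s - 1) =
      ∑ s ∈ Finset.Icc a (t - 1), nablaKernel β (t - 1 - s) * f s := by
    refine Finset.sum_bij' (fun s _ ↦ s - 1) (fun s _ ↦ s + 1) ?_ ?_ ?_ ?_ ?_
    · intro s hs
      simp only [Finset.mem_Icc] at hs ⊢
      omega
    · intro s hs
      simp only [Finset.mem_Icc] at hs ⊢
      omega
    · simp
    · simp
    · intro s _
      rw [show t - 1 - (s - 1) = t - s by ring]
  have hsplit : ∑ s ∈ Finset.Icc a (t - 1), nablaKernel β (t - 1 - s) * f s =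
      nablaKernel β (t - a - 1) * f a +
        ∑ s ∈ Finset.Icc (a + 1) (t - 1), nablaKernel β (t - 1 - s) * f s := by
    rcases le_or_gt a (t - 1) with h | h
    · rw [← Finset.insert_Icc_add_one_left_eq_Icc h, Finset.sum_insert (by simp),
        show t - a - 1 = t - 1 - a by ring]
    · rw [Finset.Icc_eq_empty (by omega), Finset.Icc_eq_empty (by omega),
        nablaKernel_of_neg β (by omega)]
      simp
  simp only [nablaOp, nablaLeftSum_eq_sum_nablaKernel, mul_sub, Finset.sum_sub_distrib]
  rw [hshift, hsplit]
  ring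

theorem nablaLeftSum_iterate_nablaOp (a : ℤ) (β : ℝ) (hβ : ∀ j : ℤ, β ≠ j) (f : ℤ → ℝ) (n : ℕ)
    (t : ℤ) :
    nablaLeftSum a β (nablaOp^[n] f) t =
      nablaOp^[n] (nablaLeftSum a β f) t -
        ∑ k ∈ Finset.range n, nablaKernel (β - n + k + 1) (t - a - 1) * (nablaOp^[k] f) a := by
  induction n generalizing t with
  | zero => simp
  | succ n ih =>
    have hk (k : ℕ) : nablaKernel (β - n + k + 1) (t - a - 1) -
        nablaKernel (β - n + k + 1) (t - 1 - a - 1) =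
          nablaKernel (β - (n + 1 : ℕ) + k + 1) (t - a - 1) := by
      rw [show t - 1 - a - 1 = t - a - 1 - 1 by ring, nablaKernel_sub]
      · congr 1
        push_cast
        ring
      · intro j h
        refine hβ (j + n - k - 1) ?_
        push_cast
        linarith
    rw [Function.iterate_succ_apply', Function.iterate_succ_apply', nablaLeftSum_nablaOp,
      Finset.sum_range_succ, show β - (n + 1 : ℕ) + n + 1 = β by push_cast; ring]
    simp only [nablaOp, ih, ← hk, sub_mul, Finset.sum_sub_distrib]
    ring

theorem stmt9 (α : ℝ) (hα : 0 < α) (hαni : ∀ m : ℤ, α ≠ (m : ℝ)) (n : ℕ)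
    (hn : (n : ℤ) = ⌊α⌋ + 1) (a : ℤ) (f : ℤ → ℝ) (t : ℤ) (ht : a + 1 ≤ t) :
    nablaLeftSum a ((n : ℝ) - α) (nablaOp^[n] f) t =
      nablaOp^[n] (nablaLeftSum a ((n : ℝ) - α) f) t -
        ∑ k ∈ Finset.range n,
          (Real.Gamma ((t : ℝ) - (a : ℝ) + (k : ℝ) - α) /
            (Real.Gamma ((t : ℝ) - (a : ℝ)) * Real.Gamma ((k : ℝ) - α + 1))) *
              (nablaOp^[k] f) a := by
  rw [nablaLeftSum_iterate_nablaOp a _ _ f n t]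
  · congr 1
    refine Finset.sum_congr rfl fun k _ ↦ ?_
    simp only [nablaKernel]
    push_cast
    congr 3 <;> ring_nf
  · intro j h
    refine hαni (n - j) ?_
    push_cast
    linarith
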